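/- arXiv:1511.07553 — 2 statements merged into one kernel-verified Lean document; each statement's English description precedes it below -/
import Mathlib

section
/- Let n ≥ 1, let g : ℝⁿ → (symmetric positive-definite n×n real matrices) be smooth and let ψ : ℝⁿ → ℝ be smooth and positive. Then for every point (r,x) ∈ ℝ × ℝⁿ and all vectors X, Y ∈ ℝ^{1+n}, the left warped product metric G_L satisfies ⟨Y, ∇_X ∂r⟩_{G_L} = ⟨X, D(log ψ)⟩_{G_L} ⟨Y, ∂r⟩_{G_L} − ⟨X, ∂r⟩_{G_L} ⟨Y, D(log ψ)⟩_{G_L}, where (∇_X ∂r)^α = Σ_β X^β Γ^α_{β0} with Γ the Christoffel symbols of G_L at (r,x). -/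
open scoped BigOperators

noncomputable section

/-- Inner product of two vectors with respect to a metric matrix `G`. -/
def minner {m : ℕ} (G : Matrix (Fin m) (Fin m) ℝ) (u v : Fin m → ℝ) : ℝ :=
  ∑ α, ∑ β, u α * G α β * v β

/-- Norm of a vector with respect to a metric matrix `G`. -/
def mnorm {m : ℕ} (G : Matrix (Fin m) (Fin m) ℝ) (v : Fin m → ℝ) : ℝ :=
  Real.sqrt (minner G v v)

/-- Christoffel symbols `Γ^α_{βγ}` of the metric `G` at the point `p`:
`Γ^α_{βγ} = (1/2) Σ_δ (G⁻¹)^{αδ}(∂_β G_{δγ} + ∂_γ G_{δβ} − ∂_δ G_{βγ})`. -/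
def christoffel {m : ℕ} (G : (Fin m → ℝ) → Matrix (Fin m) (Fin m) ℝ)
    (p : Fin m → ℝ) (α β γ : Fin m) : ℝ :=
  (1 / 2) * ∑ δ, (G p)⁻¹ α δ *
      (fderiv ℝ (fun q => G q δ γ) p (Pi.single β 1)
        + fderiv ℝ (fun q => G q δ β) p (Pi.single γ 1)
        - fderiv ℝ (fun q => G q β γ) p (Pi.single δ 1))

/-- Unit tangent vector `T = ∂ₓc/|∂ₓc|_G` of a curve `c` with respect to the metric `G`. -/
def unitT {m : ℕ} (G : (Fin m → ℝ) → Matrix (Fin m) (Fin m) ℝ)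
    (c : ℝ → Fin m → ℝ) (x : ℝ) : Fin m → ℝ :=
  (mnorm (G (c x)) (deriv c x))⁻¹ • deriv c x

/-- Covariant derivative `∇_T V` of a vector field `V` along the curve `c`. -/
def covT {m : ℕ} (G : (Fin m → ℝ) → Matrix (Fin m) (Fin m) ℝ)
    (c V : ℝ → Fin m → ℝ) (x : ℝ) : Fin m → ℝ :=
  fun α => (mnorm (G (c x)) (deriv c x))⁻¹ *
    (deriv (fun y => V y α) x
      + ∑ β, ∑ δ, christoffel G (c x) α β δ * deriv c x β * V x δ)

/-- Mean curvature vector `H = ∇_T T` of the curve `c`. -/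
def meanCurv {m : ℕ} (G : (Fin m → ℝ) → Matrix (Fin m) (Fin m) ℝ)
    (c : ℝ → Fin m → ℝ) : ℝ → Fin m → ℝ :=
  covT G c (unitT G c)

/-- Directional derivative `T(η) = |∂ₓc|⁻¹ ∂ₓη` of a scalar function along the curve `c`. -/
def Tscal {m : ℕ} (G : (Fin m → ℝ) → Matrix (Fin m) (Fin m) ℝ)
    (c : ℝ → Fin m → ℝ) (η : ℝ → ℝ) (x : ℝ) : ℝ :=
  (mnorm (G (c x)) (deriv c x))⁻¹ * deriv η x

/-- Laplacian `Δη = T(T(η))` along the curve `c`. -/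
def lapScal {m : ℕ} (G : (Fin m → ℝ) → Matrix (Fin m) (Fin m) ℝ)
    (c : ℝ → Fin m → ℝ) (η : ℝ → ℝ) : ℝ → ℝ :=
  Tscal G c (Tscal G c η)

/-- Time covariant derivative `∇_t V` along a flow `γ`. -/
def covTime {m : ℕ} (G : (Fin m → ℝ) → Matrix (Fin m) (Fin m) ℝ)
    (γ V : ℝ → ℝ → Fin m → ℝ) (x t : ℝ) : Fin m → ℝ :=
  fun α => deriv (fun s => V x s α) t
    + ∑ β, ∑ δ, christoffel G (γ x t) α β δ * deriv (fun s => γ x s β) t * V x t δ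

/-- Left warped product metric `g + ψ²(x) dr²` on `ℝ^{1+n}` (index 0 is the circle direction). -/
def gwL {n : ℕ} (g : (Fin n → ℝ) → Matrix (Fin n) (Fin n) ℝ)
    (ψ : (Fin n → ℝ) → ℝ) (p : Fin (n + 1) → ℝ) : Matrix (Fin (n + 1)) (Fin (n + 1)) ℝ :=
  Matrix.of fun α β =>
    Fin.cases (Fin.cases ((ψ fun i => p i.succ) ^ 2) (fun _ => 0) β)
      (fun i => Fin.cases 0 (fun j => g (fun k => p k.succ) i j) β) α

/-- Right warped product metric `φ²(r) g + dr²` on `ℝ^{1+n}` (index 0 is the circle direction). -/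
def gwR {n : ℕ} (g : (Fin n → ℝ) → Matrix (Fin n) (Fin n) ℝ)
    (φ : ℝ → ℝ) (p : Fin (n + 1) → ℝ) : Matrix (Fin (n + 1)) (Fin (n + 1)) ℝ :=
  Matrix.of fun α β =>
    Fin.cases (Fin.cases 1 (fun _ => 0) β)
      (fun i => Fin.cases 0 (fun j => (φ (p 0)) ^ 2 * g (fun k => p k.succ) i j) β) α

/-- The vector `∂r = e₀` in `ℝ^{1+n}`. -/
def er (n : ℕ) : Fin (n + 1) → ℝ := Pi.single 0 1

/-- The gradient `D(log ψ)` of `log ψ` with respect to `(N, g)`, as a vector in `ℝ^{1+n}`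
with vanishing 0-th component. -/
def DlogPsi {n : ℕ} (g : (Fin n → ℝ) → Matrix (Fin n) (Fin n) ℝ)
    (ψ : (Fin n → ℝ) → ℝ) (x : Fin n → ℝ) : Fin (n + 1) → ℝ :=
  Fin.cases 0 (fun i => ∑ k, (g x)⁻¹ i k *
    fderiv ℝ (fun y => Real.log (ψ y)) x (Pi.single k 1))

/-- `|D(log ψ)|² = Σ_{k,l} (g⁻¹)^{kl} ∂_k(log ψ) ∂_l(log ψ)`. -/
def normSqDlogPsi {n : ℕ} (g : (Fin n → ℝ) → Matrix (Fin n) (Fin n) ℝ)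
    (ψ : (Fin n → ℝ) → ℝ) (x : Fin n → ℝ) : ℝ :=
  ∑ k, ∑ l, (g x)⁻¹ k l *
    fderiv ℝ (fun y => Real.log (ψ y)) x (Pi.single k 1) *
    fderiv ℝ (fun y => Real.log (ψ y)) x (Pi.single l 1)

/-- `∇_X ∂r` at the point `p`, i.e. `(∇_X ∂r)^α = Σ_β X^β Γ^α_{β0}`. -/
def covR {m : ℕ} [NeZero m] (G : (Fin m → ℝ) → Matrix (Fin m) (Fin m) ℝ)
    (p : Fin m → ℝ) (X : Fin m → ℝ) : Fin m → ℝ :=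
  fun α => ∑ β, X β * christoffel G p α β 0

/-- The angle function `Θ_L = ⟨T, ∂r⟩_{G_L}` of a flow `γ` in the left warped product. -/
def thetaL {n : ℕ} (g : (Fin n → ℝ) → Matrix (Fin n) (Fin n) ℝ)
    (ψ : (Fin n → ℝ) → ℝ) (γ : ℝ → ℝ → Fin (n + 1) → ℝ) (x t : ℝ) : ℝ :=
  minner (gwL g ψ (γ x t)) (unitT (gwL g ψ) (fun y => γ y t) x) (er n)

/-- The angle function `Θ_R = ⟨T, ∂r⟩_{G_R}` of a flow `γ` in the right warped product. -/
def thetaR {n : ℕ} (g : (Fin n → ℝ) → Matrix (Fin n) (Fin n) ℝ)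
    (φ : ℝ → ℝ) (γ : ℝ → ℝ → Fin (n + 1) → ℝ) (x t : ℝ) : ℝ :=
  minner (gwR g φ (γ x t)) (unitT (gwR g φ) (fun y => γ y t) x) (er n)

theorem fderiv_comp_tail {n : ℕ} {f : (Fin n → ℝ) → ℝ} {p : Fin (n + 1) → ℝ}
    (hf : DifferentiableAt ℝ f (fun i => p i.succ)) (v : Fin (n + 1) → ℝ) :
    fderiv ℝ (fun q : Fin (n + 1) → ℝ => f fun i => q i.succ) p v
      = fderiv ℝ f (fun i => p i.succ) (fun i => v i.succ) := by
  let L : (Fin (n + 1) → ℝ) →L[ℝ] (Fin n → ℝ) :=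
    ContinuousLinearMap.pi fun i => ContinuousLinearMap.proj i.succ
  have hL : DifferentiableAt ℝ f (L p) := hf
  have h := (hL.hasFDerivAt.comp p L.hasFDerivAt).fderiv
  exact congrArg (fun T : (Fin (n + 1) → ℝ) →L[ℝ] ℝ => T v) h

theorem det_gwL {n : ℕ} (g : (Fin n → ℝ) → Matrix (Fin n) (Fin n) ℝ)
    (ψ : (Fin n → ℝ) → ℝ) (p : Fin (n + 1) → ℝ) :
    (gwL g ψ p).det = (ψ fun i => p i.succ) ^ 2 * (g fun i => p i.succ).det := by
  rw [Matrix.det_succ_column_zero, Fin.sum_univ_succ]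
  have h : (gwL g ψ p).submatrix (Fin.succAbove 0) Fin.succ = g fun i => p i.succ := by
    ext i j
    simp [gwL]
  simp only [h]
  simp [gwL]

/-- Lowering the upper index of the Christoffel symbols. -/
theorem sum_metric_mul_christoffel {m : ℕ} (G : (Fin m → ℝ) → Matrix (Fin m) (Fin m) ℝ)
    (p : Fin m → ℝ) (hG : IsUnit (G p).det) (δ β γ : Fin m) :
    ∑ α, G p δ α * christoffel G p α β γ
      = (1 / 2) * (fderiv ℝ (fun q => G q δ γ) p (Pi.single β 1)
        + fderiv ℝ (fun q => G q δ β) p (Pi.single γ 1)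
        - fderiv ℝ (fun q => G q β γ) p (Pi.single δ 1)) := by
  set w : Fin m → ℝ := fun δ => fderiv ℝ (fun q => G q δ γ) p (Pi.single β 1)
        + fderiv ℝ (fun q => G q δ β) p (Pi.single γ 1)
        - fderiv ℝ (fun q => G q β γ) p (Pi.single δ 1)
  have h : (G p).mulVec ((G p)⁻¹.mulVec w) δ = w δ := by
    rw [Matrix.mulVec_mulVec, Matrix.mul_nonsing_inv _ hG, Matrix.one_mulVec]
  change ∑ α, G p δ α * ((1 / 2) * ∑ δ, (G p)⁻¹ α δ * w δ) = (1 / 2) * w δ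
  rw [← h]
  simp only [Matrix.mulVec, dotProduct, Finset.mul_sum]
  exact Finset.sum_congr rfl fun α _ => Finset.sum_congr rfl fun _ _ => by ring

theorem minner_covR {m : ℕ} [NeZero m] (G : (Fin m → ℝ) → Matrix (Fin m) (Fin m) ℝ)
    (p : Fin m → ℝ) (hG : IsUnit (G p).det) (X Y : Fin m → ℝ) :
    minner (G p) Y (covR G p X)
      = ∑ δ, ∑ β, Y δ * X β * ((1 / 2) * (fderiv ℝ (fun q => G q δ 0) p (Pi.single β 1)
        + fderiv ℝ (fun q => G q δ β) p (Pi.single 0 1)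
        - fderiv ℝ (fun q => G q β 0) p (Pi.single δ 1))) := by
  simp only [← sum_metric_mul_christoffel G p hG, minner, covR, Finset.mul_sum]
  refine Finset.sum_congr rfl fun δ _ => ?_
  rw [Finset.sum_comm]
  exact Finset.sum_congr rfl fun α _ => Finset.sum_congr rfl fun _ _ => by ring

theorem minner_gwL_er {n : ℕ} (g : (Fin n → ℝ) → Matrix (Fin n) (Fin n) ℝ)
    (ψ : (Fin n → ℝ) → ℝ) (r : ℝ) (x : Fin n → ℝ) (X : Fin (n + 1) → ℝ) :
    minner (gwL g ψ (Fin.cons r x)) X (er n) = X 0 * ψ x ^ 2 := by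
  simp [minner, er, gwL, Fin.sum_univ_succ]

theorem minner_gwL_DlogPsi {n : ℕ} (g : (Fin n → ℝ) → Matrix (Fin n) (Fin n) ℝ)
    (ψ : (Fin n → ℝ) → ℝ) (r : ℝ) (x : Fin n → ℝ) (hg : IsUnit (g x).det)
    (hψ : DifferentiableAt ℝ ψ x) (hψ0 : ψ x ≠ 0) (X : Fin (n + 1) → ℝ) :
    minner (gwL g ψ (Fin.cons r x)) X (DlogPsi g ψ x)
      = ∑ i : Fin n, X i.succ * ((ψ x)⁻¹ * fderiv ℝ ψ x (Pi.single i 1)) := by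
  set w : Fin n → ℝ := fun k => fderiv ℝ (fun y => Real.log (ψ y)) x (Pi.single k 1) with hw
  have h : (g x).mulVec ((g x)⁻¹.mulVec w) = w := by
    rw [Matrix.mulVec_mulVec, Matrix.mul_nonsing_inv _ hg, Matrix.one_mulVec]
  have hlog (i : Fin n) : w i = (ψ x)⁻¹ * fderiv ℝ ψ x (Pi.single i 1) := by
    simp [hw, fderiv.log hψ hψ0]
  have hD : DlogPsi g ψ x = Fin.cases 0 ((g x)⁻¹.mulVec w) := rfl
  simp only [← hlog]
  rw [← h, hD, minner, Fin.sum_univ_succ]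
  simp [gwL, Fin.sum_univ_succ, Matrix.mulVec, dotProduct, Finset.mul_sum, mul_assoc]

theorem fderiv_gwL_zero_zero {n : ℕ} (g : (Fin n → ℝ) → Matrix (Fin n) (Fin n) ℝ)
    {ψ : (Fin n → ℝ) → ℝ} {r : ℝ} {x : Fin n → ℝ} (hψ : DifferentiableAt ℝ ψ x)
    (v : Fin (n + 1) → ℝ) :
    fderiv ℝ (fun q => gwL g ψ q 0 0) (Fin.cons r x) v
      = 2 * ψ x * fderiv ℝ ψ x (fun i => v i.succ) := by
  refine (fderiv_comp_tail (f := fun y => ψ y ^ 2) (p := Fin.cons r x) (hψ.pow 2) v).trans ?_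
  simp [fderiv_fun_pow 2 hψ]

theorem fderiv_gwL_succ_succ_single_zero {n : ℕ} {g : (Fin n → ℝ) → Matrix (Fin n) (Fin n) ℝ}
    (ψ : (Fin n → ℝ) → ℝ) {r : ℝ} {x : Fin n → ℝ} {i j : Fin n}
    (hg : DifferentiableAt ℝ (fun y => g y i j) x) :
    fderiv ℝ (fun q => gwL g ψ q i.succ j.succ) (Fin.cons r x) (Pi.single 0 1) = 0 := by
  refine (fderiv_comp_tail (f := fun y => g y i j) (p := Fin.cons r x) hg _).trans ?_
  have h : (fun k : Fin n => (Pi.single 0 1 : Fin (n + 1) → ℝ) k.succ) = 0 := by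
    ext k
    simp
  rw [h, map_zero]

/-- `⟨Y, ∇_X ∂r⟩ = ⟨X, D(log ψ)⟩⟨Y, ∂r⟩ − ⟨X, ∂r⟩⟨Y, D(log ψ)⟩` in the left warped product. -/
theorem stmt1 {n : ℕ} (hn : 1 ≤ n)
    (g : (Fin n → ℝ) → Matrix (Fin n) (Fin n) ℝ)
    (hg : ∀ i j, ContDiff ℝ (⊤ : ℕ∞) fun x => g x i j)
    (hgpd : ∀ x, (g x).PosDef)
    (ψ : (Fin n → ℝ) → ℝ) (hψ : ContDiff ℝ (⊤ : ℕ∞) ψ) (hψpos : ∀ x, 0 < ψ x)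
    (r : ℝ) (x : Fin n → ℝ) (X Y : Fin (n + 1) → ℝ) :
    minner (gwL g ψ (Fin.cons r x)) Y (covR (gwL g ψ) (Fin.cons r x) X)
      = minner (gwL g ψ (Fin.cons r x)) X (DlogPsi g ψ x)
          * minner (gwL g ψ (Fin.cons r x)) Y (er n)
        - minner (gwL g ψ (Fin.cons r x)) X (er n)
          * minner (gwL g ψ (Fin.cons r x)) Y (DlogPsi g ψ x) := by
  have hψx : DifferentiableAt ℝ ψ x := hψ.differentiable (by simp) x
  have hψ0 : ψ x ≠ 0 := (hψpos x).ne'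
  have hgx : IsUnit (g x).det := (hgpd x).det_pos.ne'.isUnit
  have hG : IsUnit (gwL g ψ (Fin.cons r x)).det := by
    rw [det_gwL]
    exact (mul_ne_zero (pow_ne_zero 2 hψ0) (hgpd x).det_pos.ne').isUnit
  have hgij (i j : Fin n) := fderiv_gwL_succ_succ_single_zero ψ (r := r)
    ((hg i j).differentiable (by simp) x)
  have h0 (i : Fin n) : (fun q => gwL g ψ q i.succ 0) = fun _ => 0 := rfl
  have h0' (i : Fin n) : (fun q => gwL g ψ q 0 i.succ) = fun _ => 0 := rfl
  have hs0 : (fun k : Fin n => (Pi.single 0 1 : Fin (n + 1) → ℝ) k.succ) = 0 := by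
    ext k
    simp
  have hs (i : Fin n) : (fun k : Fin n => (Pi.single i.succ 1 : Fin (n + 1) → ℝ) k.succ)
      = Pi.single i 1 := by
    ext k
    simp [Pi.single_apply]
  rw [minner_covR _ _ hG, minner_gwL_er, minner_gwL_er,
    minner_gwL_DlogPsi g ψ r x hgx hψx hψ0, minner_gwL_DlogPsi g ψ r x hgx hψx hψ0]
  simp only [Fin.sum_univ_succ, hgij, h0, h0', fderiv_gwL_zero_zero g hψx, hs0, hs]
  simp only [fderiv_fun_const, Pi.zero_apply, zero_apply, map_zero, mul_zero,
    add_zero, zero_add, sub_zero, zero_sub, Finset.sum_const_zero, Finset.sum_mul,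
    Finset.mul_sum]
  rw [sub_eq_add_neg, ← Finset.sum_neg_distrib]
  congr 1 <;> refine Finset.sum_congr rfl fun i _ => ?_ <;> field_simp

end
end

section
/- Let n ≥ 1, let g : ℝⁿ → (symmetric positive-definite n×n real matrices) be smooth, let ψ : ℝⁿ → ℝ be smooth and positive, and let γ : ℝ → ℝ^{1+n} be a smooth regular curve (∂ₓγ ≠ 0). With T the unit tangent and H = ∇_T T computed with respect to the left warped product metric G_L, the angle function Θ_L = ⟨T, ∂r⟩_{G_L} satisfies T(Θ_L) = ⟨H, ∂r⟩_{G_L}, i.e. |∂ₓγ|_{G_L}^{-1} ∂ₓΘ_L = ⟨H, ∂r⟩_{G_L}. -/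
open scoped BigOperators

noncomputable section

theorem minner_eq_dotProduct {m : ℕ} (G : Matrix (Fin m) (Fin m) ℝ) (u v : Fin m → ℝ) :
    minner G u v = u ⬝ᵥ G.mulVec v := by
  simp only [minner, dotProduct, Matrix.mulVec, Finset.mul_sum, mul_assoc]

theorem minner_single {m : ℕ} (G : Matrix (Fin m) (Fin m) ℝ) (u : Fin m → ℝ) (k : Fin m) :
    minner G u (Pi.single k 1) = ∑ α, u α * G α k := by
  rw [minner_eq_dotProduct, Matrix.mulVec_single_one]
  rfl

theorem Matrix.PosDef.minner_pos {m : ℕ} {G : Matrix (Fin m) (Fin m) ℝ} (hG : G.PosDef)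
    {v : Fin m → ℝ} (hv : v ≠ 0) : 0 < minner G v v := by
  simpa [minner_eq_dotProduct] using hG.dotProduct_mulVec_pos hv

/-- Christoffel symbols with the upper index lowered. -/
theorem sum_mul_christoffel {m : ℕ} {G : (Fin m → ℝ) → Matrix (Fin m) (Fin m) ℝ}
    {p : Fin m → ℝ} (hsymm : (G p).IsSymm) (hdet : IsUnit (G p).det) (k β γ : Fin m) :
    ∑ α, G p α k * christoffel G p α β γ =
      (1 / 2) * (fderiv ℝ (fun q => G q k γ) p (Pi.single β 1)
        + fderiv ℝ (fun q => G q k β) p (Pi.single γ 1)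
        - fderiv ℝ (fun q => G q β γ) p (Pi.single k 1)) := by
  set L : Fin m → ℝ := fun δ => fderiv ℝ (fun q => G q δ γ) p (Pi.single β 1)
        + fderiv ℝ (fun q => G q δ β) p (Pi.single γ 1)
        - fderiv ℝ (fun q => G q β γ) p (Pi.single δ 1)
  have h : (G p).mulVec ((G p)⁻¹.mulVec L) = L := by
    rw [Matrix.mulVec_mulVec, Matrix.mul_nonsing_inv _ hdet, Matrix.one_mulVec]
  have hk : ∑ α, G p k α * ∑ δ, (G p)⁻¹ α δ * L δ = L k := congrFun h k
  change ∑ α, G p α k * ((1 / 2) * ∑ δ, (G p)⁻¹ α δ * L δ) = (1 / 2) * L k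
  rw [← hk, Finset.mul_sum]
  refine Finset.sum_congr rfl fun α _ => ?_
  rw [hsymm.apply k α]
  ring

theorem fderiv_apply_eq_sum_single {m : ℕ} (f : (Fin m → ℝ) → ℝ) (p v : Fin m → ℝ) :
    fderiv ℝ f p v = ∑ β, v β * fderiv ℝ f p (Pi.single β 1) := by
  conv_lhs => rw [pi_eq_sum_univ' v, map_sum]
  refine Finset.sum_congr rfl fun β _ => ?_
  rw [map_smul, smul_eq_mul]

/-- If the metric does not depend on the `k`-th coordinate, then `T⟨T, e_k⟩ = ⟨H, e_k⟩`. -/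
theorem Tscal_minner_unitT_single {m : ℕ} {G : (Fin m → ℝ) → Matrix (Fin m) (Fin m) ℝ}
    {c : ℝ → Fin m → ℝ} {x : ℝ} {k : Fin m}
    (hsymm : ∀ p, (G p).IsSymm) (hdet : IsUnit (G (c x)).det)
    (hG : ∀ α β, DifferentiableAt ℝ (fun q => G q α β) (c x))
    (hkill : ∀ α β, fderiv ℝ (fun q => G q α β) (c x) (Pi.single k 1) = 0)
    (hc : DifferentiableAt ℝ c x) (hT : DifferentiableAt ℝ (unitT G c) x) :
    Tscal G c (fun y => minner (G (c y)) (unitT G c y) (Pi.single k 1)) x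
      = minner (G (c x)) (meanCurv G c x) (Pi.single k 1) := by
  set D : Fin m → Fin m → ℝ :=
    fun δ β => fderiv ℝ (fun q => G q k δ) (c x) (Pi.single β 1) with hD
  have hTα : ∀ α, DifferentiableAt ℝ (fun y => unitT G c y α) x :=
    fun α => differentiableAt_pi.1 hT α
  have hGc : ∀ α, HasDerivAt (fun y => G (c y) α k) (∑ β, deriv c x β * D α β) x := by
    intro α
    have h := (hG k α).hasFDerivAt.comp_hasDerivAt x hc.hasDerivAt
    rw [fderiv_apply_eq_sum_single] at h
    simpa only [hD, Function.comp_def, (hsymm _).apply α k] using h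
  have hderiv : deriv (fun y => ∑ α, unitT G c y α * G (c y) α k) x =
      ∑ α, (deriv (fun y => unitT G c y α) x * G (c x) α k
        + unitT G c x α * ∑ β, deriv c x β * D α β) :=
    (HasDerivAt.fun_sum fun α _ => (hTα α).hasDerivAt.mul (hGc α)).deriv
  have hchr : ∑ α, (∑ β, ∑ δ, christoffel G (c x) α β δ * deriv c x β * unitT G c x δ)
        * G (c x) α k
      = ∑ α, unitT G c x α * ∑ β, deriv c x β * D α β := by
    calc _ = ∑ β, ∑ δ, (∑ α, G (c x) α k * christoffel G (c x) α β δ)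
            * (deriv c x β * unitT G c x δ) := by
          simp only [Finset.sum_mul]
          rw [Finset.sum_comm]
          refine Finset.sum_congr rfl fun β _ => ?_
          rw [Finset.sum_comm]
          exact Finset.sum_congr rfl fun δ _ => Finset.sum_congr rfl fun α _ => by ring
      _ = (1 / 2) * (∑ β, ∑ δ, D δ β * (deriv c x β * unitT G c x δ))
            + (1 / 2) * ∑ β, ∑ δ, D β δ * (deriv c x β * unitT G c x δ) := by
          simp only [sum_mul_christoffel (hsymm _) hdet, hkill, Finset.mul_sum,
            ← Finset.sum_add_distrib]
          exact Finset.sum_congr rfl fun β _ => Finset.sum_congr rfl fun δ _ => by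
            simp only [hD]; ring
      _ = ∑ β, ∑ δ, D β δ * (deriv c x β * unitT G c x δ) := by
          have : ∑ β, ∑ δ, D δ β * (deriv c x β * unitT G c x δ)
              = ∑ β, ∑ δ, D β δ * (deriv c x β * unitT G c x δ) := by
            rw [Finset.sum_comm]
            refine Finset.sum_congr rfl fun β _ => Finset.sum_congr rfl fun δ _ => ?_
            simp only [unitT, Pi.smul_apply, smul_eq_mul]
            ring
          rw [this]
          ring
      _ = _ := by
          simp only [Finset.mul_sum]
          refine Finset.sum_congr rfl fun β _ => Finset.sum_congr rfl fun δ _ => ?_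
          simp only [unitT, Pi.smul_apply, smul_eq_mul]
          ring
  simp only [minner_single, Tscal, meanCurv, covT]
  rw [hderiv, Finset.sum_add_distrib, ← hchr, ← Finset.sum_add_distrib, Finset.mul_sum]
  exact Finset.sum_congr rfl fun α _ => by ring

theorem DifferentiableAt.unitT {m : ℕ} {G : (Fin m → ℝ) → Matrix (Fin m) (Fin m) ℝ}
    {c : ℝ → Fin m → ℝ} {x : ℝ} (hpd : (G (c x)).PosDef)
    (hG : ∀ α β, DifferentiableAt ℝ (fun q => G q α β) (c x))
    (hc : DifferentiableAt ℝ c x) (hc' : DifferentiableAt ℝ (deriv c) x)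
    (hreg : deriv c x ≠ 0) : DifferentiableAt ℝ (unitT G c) x := by
  have hpos := hpd.minner_pos hreg
  have hGc : ∀ α β, DifferentiableAt ℝ (fun y => G (c y) α β) x :=
    fun α β => (hG α β).comp x hc
  have hcα : ∀ α, DifferentiableAt ℝ (fun y => deriv c y α) x :=
    fun α => differentiableAt_pi.1 hc' α
  have hm : DifferentiableAt ℝ (fun y => minner (G (c y)) (deriv c y) (deriv c y)) x :=
    DifferentiableAt.fun_sum fun α _ => DifferentiableAt.fun_sum fun β _ =>
      ((hcα α).mul (hGc α β)).mul (hcα β)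
  exact ((hm.sqrt hpos.ne').inv (Real.sqrt_pos.2 hpos).ne').smul hc'

theorem gwL_isSymm {n : ℕ} {g : (Fin n → ℝ) → Matrix (Fin n) (Fin n) ℝ}
    (hg : ∀ x, (g x).IsSymm) (ψ : (Fin n → ℝ) → ℝ) (p : Fin (n + 1) → ℝ) :
    (gwL g ψ p).IsSymm := by
  refine Matrix.IsSymm.ext fun α β => ?_
  cases α using Fin.cases <;> cases β using Fin.cases <;> simp [gwL, (hg _).apply]

theorem gwL_posDef {n : ℕ} {g : (Fin n → ℝ) → Matrix (Fin n) (Fin n) ℝ}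
    (hg : ∀ x, (g x).PosDef) {ψ : (Fin n → ℝ) → ℝ} (hψ : ∀ x, 0 < ψ x)
    (p : Fin (n + 1) → ℝ) : (gwL g ψ p).PosDef := by
  refine Matrix.PosDef.of_dotProduct_mulVec_pos ?_ fun v hv => ?_
  · have := gwL_isSymm (fun x => by simpa using (hg x).isHermitian) ψ p
    simpa using this
  · have key : minner (gwL g ψ p) v v =
        (ψ fun i => p i.succ) ^ 2 * v 0 ^ 2
          + minner (g fun i => p i.succ) (fun i => v i.succ) (fun i => v i.succ) := by
      simp only [minner, gwL, Fin.sum_univ_succ, Matrix.of_apply, Fin.cases_zero, Fin.cases_succ]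
      simp
      ring
    rw [star_trivial, ← minner_eq_dotProduct, key]
    by_cases h : (fun i : Fin n => v i.succ) = 0
    · have h0 : v 0 ≠ 0 := fun h0 => hv <| funext fun i =>
        Fin.cases h0 (fun j => congrFun h j) i
      have := hψ fun i => p i.succ
      have hz : minner (g fun i => p i.succ) (0 : Fin n → ℝ) 0 = 0 := by simp [minner]
      rw [h, hz]
      positivity
    · have := (hg fun i => p i.succ).minner_pos h
      positivity

theorem differentiable_gwL {n : ℕ} {g : (Fin n → ℝ) → Matrix (Fin n) (Fin n) ℝ}
    (hg : ∀ i j, Differentiable ℝ fun x => g x i j) {ψ : (Fin n → ℝ) → ℝ}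
    (hψ : Differentiable ℝ ψ) (α β : Fin (n + 1)) :
    Differentiable ℝ fun p => gwL g ψ p α β := by
  have htail : Differentiable ℝ fun (p : Fin (n + 1) → ℝ) (i : Fin n) => p i.succ := by fun_prop
  cases α using Fin.cases with
  | zero =>
    cases β using Fin.cases with
    | zero => exact (hψ.comp htail).pow 2
    | succ j => exact differentiable_const 0
  | succ i =>
    cases β using Fin.cases with
    | zero => exact differentiable_const 0
    | succ j => exact (hg i j).comp htail

theorem gwL_add_smul_er {n : ℕ} (g : (Fin n → ℝ) → Matrix (Fin n) (Fin n) ℝ)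
    (ψ : (Fin n → ℝ) → ℝ) (p : Fin (n + 1) → ℝ) (t : ℝ) :
    gwL g ψ (p + t • er n) = gwL g ψ p := by
  simp [gwL, er]

theorem fderiv_gwL_er {n : ℕ} {g : (Fin n → ℝ) → Matrix (Fin n) (Fin n) ℝ}
    (hg : ∀ i j, Differentiable ℝ fun x => g x i j) {ψ : (Fin n → ℝ) → ℝ}
    (hψ : Differentiable ℝ ψ) (α β : Fin (n + 1)) (p : Fin (n + 1) → ℝ) :
    fderiv ℝ (fun q => gwL g ψ q α β) p (er n) = 0 := by
  rw [← (differentiable_gwL hg hψ α β p).lineDeriv_eq_fderiv]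
  simp [lineDeriv, gwL_add_smul_er]

/-- For a regular curve in the left warped product, `T(Θ_L) = ⟨H, ∂r⟩`. -/
theorem stmt6 {n : ℕ} (hn : 1 ≤ n)
    (g : (Fin n → ℝ) → Matrix (Fin n) (Fin n) ℝ)
    (hg : ∀ i j, ContDiff ℝ (⊤ : ℕ∞) fun x => g x i j)
    (hgpd : ∀ x, (g x).PosDef)
    (ψ : (Fin n → ℝ) → ℝ) (hψ : ContDiff ℝ (⊤ : ℕ∞) ψ) (hψpos : ∀ x, 0 < ψ x)
    (γ : ℝ → Fin (n + 1) → ℝ) (hγ : ContDiff ℝ (⊤ : ℕ∞) γ)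
    (hreg : ∀ x, deriv γ x ≠ 0) (x : ℝ) :
    Tscal (gwL g ψ) γ (fun y => minner (gwL g ψ (γ y)) (unitT (gwL g ψ) γ y) (er n)) x
      = minner (gwL g ψ (γ x)) (meanCurv (gwL g ψ) γ x) (er n) := by
  have hgd : ∀ i j, Differentiable ℝ fun x => g x i j :=
    fun i j => (hg i j).differentiable (by simp)
  have hψd : Differentiable ℝ ψ := hψ.differentiable (by simp)
  have hγd : Differentiable ℝ γ := hγ.differentiable (by simp)
  have hγd' : Differentiable ℝ (deriv γ) :=
    ((contDiff_infty_iff_deriv.1 hγ).2).differentiable (by simp)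
  have hpd := gwL_posDef hgpd hψpos
  have hGd := differentiable_gwL hgd hψd
  exact Tscal_minner_unitT_single
    (gwL_isSymm (fun x => by simpa using (hgpd x).isHermitian) ψ)
    (hpd (γ x)).det_pos.ne'.isUnit (fun α β => hGd α β (γ x))
    (fun α β => fderiv_gwL_er hgd hψd α β (γ x)) (hγd x)
    (DifferentiableAt.unitT (hpd (γ x)) (fun α β => hGd α β (γ x)) (hγd x) (hγd' x) (hreg x))

end
end
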